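/- Sturm oscillation theorem: for q ∈ L¹([0,π]; ℝ), α ∈ (0,π], β ∈ [0,π), any eigenfunction of L(q, α, β) corresponding to the n-th eigenvalue μₙ(q, α, β) has exactly n zeros in the open interval (0, π), and all these zeros are simple. -/

import Mathlib

open Real MeasureTheory Set

noncomputable section

/-- `y` (with derivative `y'`) is a (Carathéodory) solution of `-y'' + q y = μ y` on `[0, π]`,
written in integral form. -/
def SLSol (q : ℝ → ℝ) (μ : ℝ) (y y' : ℝ → ℝ) : Prop :=
  ContinuousOn y (Icc 0 π) ∧ ContinuousOn y' (Icc 0 π) ∧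
  (∀ x ∈ Icc (0:ℝ) π, y x = y 0 + ∫ t in (0:ℝ)..x, y' t) ∧
  (∀ x ∈ Icc (0:ℝ) π, y' x = y' 0 + ∫ t in (0:ℝ)..x, (q t - μ) * y t)

/-- `y` (with derivative `y'`) solves the inhomogeneous equation `-y'' + q y = g + μ y`
(equivalently `y'' = (q - μ) y - g`) on `[0, π]`, in integral form.  With `g` the original
solution, this is the equation satisfied by the `μ`-derivative of a solution. -/
def SLSolInh (q : ℝ → ℝ) (μ : ℝ) (g y y' : ℝ → ℝ) : Prop :=
  ContinuousOn y (Icc 0 π) ∧ ContinuousOn y' (Icc 0 π) ∧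
  (∀ x ∈ Icc (0:ℝ) π, y x = y 0 + ∫ t in (0:ℝ)..x, y' t) ∧
  (∀ x ∈ Icc (0:ℝ) π, y' x = y' 0 + ∫ t in (0:ℝ)..x, ((q t - μ) * y t - g t))

/-- `y` (with derivative `y'`) is an eigenfunction of the Sturm–Liouville problem
`L(q, α, β)` with eigenvalue `μ`. -/
def IsEigenpair (q : ℝ → ℝ) (α β μ : ℝ) (y y' : ℝ → ℝ) : Prop :=
  SLSol q μ y y' ∧ (∃ x ∈ Icc (0:ℝ) π, y x ≠ 0) ∧
  y 0 * Real.cos α + y' 0 * Real.sin α = 0 ∧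
  y π * Real.cos β + y' π * Real.sin β = 0

/-- `μ` is an eigenvalue of the Sturm–Liouville problem `L(q, α, β)`. -/
def IsEigenvalue (q : ℝ → ℝ) (α β μ : ℝ) : Prop :=
  ∃ y y', IsEigenpair q α β μ y y'

theorem AbsolutelyContinuousOnInterval.lipschitzOnWith_comp {φ f : ℝ → ℝ} {a b : ℝ} {s : Set ℝ}
    {K : NNReal} (hf : AbsolutelyContinuousOnInterval f a b) (hφ : LipschitzOnWith K φ s)
    (hs : MapsTo f (uIcc a b) s) : AbsolutelyContinuousOnInterval (φ ∘ f) a b := by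
  rw [absolutelyContinuousOnInterval_iff] at hf ⊢
  intro ε hε
  obtain ⟨δ, hδ, h⟩ := hf (ε / (K + 1)) (by positivity)
  refine ⟨δ, hδ, fun E hE hE' ↦ ?_⟩
  have h1 := h E hE hE'
  have h2 : ∑ i ∈ Finset.range E.1, dist ((φ ∘ f) (E.2 i).1) ((φ ∘ f) (E.2 i).2) ≤
      K * ∑ i ∈ Finset.range E.1, dist (f (E.2 i).1) (f (E.2 i).2) := by
    rw [Finset.mul_sum]
    refine Finset.sum_le_sum fun i hi ↦ ?_
    obtain ⟨ha, hb⟩ := hE.1 i hi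
    exact hφ.dist_le_mul _ (hs ha) _ (hs hb)
  have h3 : 0 ≤ ∑ i ∈ Finset.range E.1, dist (f (E.2 i).1) (f (E.2 i).2) :=
    Finset.sum_nonneg fun _ _ ↦ dist_nonneg
  rw [lt_div_iff₀ (by positivity)] at h1
  nlinarith [K.coe_nonneg]

theorem AbsolutelyContinuousOnInterval.congr {f g : ℝ → ℝ} {a b : ℝ}
    (hf : AbsolutelyContinuousOnInterval f a b) (h : EqOn f g (uIcc a b)) :
    AbsolutelyContinuousOnInterval g a b := by
  rw [absolutelyContinuousOnInterval_iff] at hf ⊢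
  intro ε hε
  obtain ⟨δ, hδ, H⟩ := hf ε hε
  refine ⟨δ, hδ, fun E hE hE' ↦ ?_⟩
  convert H E hE hE' using 1
  refine Finset.sum_congr rfl fun i hi ↦ ?_
  rw [h (hE.1 i hi).1, h (hE.1 i hi).2]

/-- `f` is an indefinite integral of the integrable function `g` on `[a, b]`. -/
structure IsIntegralOf (f g : ℝ → ℝ) (a b : ℝ) : Prop where
  intervalIntegrable : IntervalIntegrable g volume a b
  eq_add_integral : ∀ x ∈ Icc a b, f x = f a + ∫ t in a..x, g t

namespace IsIntegralOf

variable {f g f₁ g₁ f₂ g₂ : ℝ → ℝ} {a b : ℝ}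

theorem absolutelyContinuousOnInterval (h : IsIntegralOf f g a b) (hab : a ≤ b) :
    AbsolutelyContinuousOnInterval f a b := by
  have h1 := h.intervalIntegrable.absolutelyContinuousOnInterval_intervalIntegral
    (c := a) left_mem_uIcc
  have h2 : AbsolutelyContinuousOnInterval (fun _ ↦ f a) a b :=
    (LipschitzWith.const (f a)).lipschitzOnWith.absolutelyContinuousOnInterval
  refine (h2.fun_add h1).congr fun x hx ↦ ?_
  rw [uIcc_of_le hab] at hx
  exact (h.eq_add_integral x hx).symm

theorem continuousOn (h : IsIntegralOf f g a b) (hab : a ≤ b) : ContinuousOn f (Icc a b) := by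
  simpa [uIcc_of_le hab] using (h.absolutelyContinuousOnInterval hab).continuousOn

theorem ae_hasDerivAt (h : IsIntegralOf f g a b) (hab : a ≤ b) :
    ∀ᵐ x, x ∈ uIcc a b → HasDerivAt f (g x) x := by
  filter_upwards [h.intervalIntegrable.ae_hasDerivAt_integral, volume.ae_ne a, volume.ae_ne b]
    with x hx hxa hxb hxm
  have h1 := (hx hxm a left_mem_uIcc).const_add (f a)
  rw [uIcc_of_le hab] at hxm
  refine h1.congr_of_eventuallyEq ?_
  filter_upwards [Icc_mem_nhds (lt_of_le_of_ne hxm.1 hxa.symm) (lt_of_le_of_ne hxm.2 hxb)]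
    with y hy using h.eq_add_integral y hy

theorem of_ae_hasDerivAt (hf : AbsolutelyContinuousOnInterval f a b)
    (hg : ∀ᵐ x, x ∈ uIcc a b → HasDerivAt f (g x) x) (hab : a ≤ b) : IsIntegralOf f g a b := by
  have key : ∀ᵐ x, x ∈ uIoc a b → deriv f x = g x := by
    filter_upwards [hg] with x hx hxm using (hx (uIoc_subset_uIcc hxm)).deriv
  refine ⟨hf.intervalIntegrable_deriv.congr_ae ((ae_restrict_iff' measurableSet_uIoc).2 key),
    fun x hx ↦ ?_⟩
  have hsub : uIcc a x ⊆ uIcc a b := by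
    rw [uIcc_of_le hab, uIcc_of_le hx.1]; exact Icc_subset_Icc_right hx.2
  have h1 := (hf.mono hsub).integral_deriv_eq_sub
  have h2 : ∫ t in a..x, deriv f t = ∫ t in a..x, g t := by
    refine intervalIntegral.integral_congr_ae ?_
    filter_upwards [hg] with t ht htm using (ht (hsub (uIoc_subset_uIcc htm))).deriv
  linarith

theorem mul (h₁ : IsIntegralOf f₁ g₁ a b) (h₂ : IsIntegralOf f₂ g₂ a b) (hab : a ≤ b) :
    IsIntegralOf (fun x ↦ f₁ x * f₂ x) (fun x ↦ g₁ x * f₂ x + f₁ x * g₂ x) a b := by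
  refine of_ae_hasDerivAt ((h₁.absolutelyContinuousOnInterval hab).fun_mul
    (h₂.absolutelyContinuousOnInterval hab)) ?_ hab
  filter_upwards [h₁.ae_hasDerivAt hab, h₂.ae_hasDerivAt hab] with x hx₁ hx₂ hx
  exact (hx₁ hx).mul (hx₂ hx)

theorem add (h₁ : IsIntegralOf f₁ g₁ a b) (h₂ : IsIntegralOf f₂ g₂ a b) (hab : a ≤ b) :
    IsIntegralOf (fun x ↦ f₁ x + f₂ x) (fun x ↦ g₁ x + g₂ x) a b := by
  refine of_ae_hasDerivAt ((h₁.absolutelyContinuousOnInterval hab).fun_add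
    (h₂.absolutelyContinuousOnInterval hab)) ?_ hab
  filter_upwards [h₁.ae_hasDerivAt hab, h₂.ae_hasDerivAt hab] with x hx₁ hx₂ hx
  exact (hx₁ hx).add (hx₂ hx)

theorem sub (h₁ : IsIntegralOf f₁ g₁ a b) (h₂ : IsIntegralOf f₂ g₂ a b) (hab : a ≤ b) :
    IsIntegralOf (fun x ↦ f₁ x - f₂ x) (fun x ↦ g₁ x - g₂ x) a b := by
  refine of_ae_hasDerivAt ((h₁.absolutelyContinuousOnInterval hab).fun_sub
    (h₂.absolutelyContinuousOnInterval hab)) ?_ hab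
  filter_upwards [h₁.ae_hasDerivAt hab, h₂.ae_hasDerivAt hab] with x hx₁ hx₂ hx
  exact (hx₁ hx).sub (hx₂ hx)

theorem comp {φ φ' : ℝ → ℝ} (h : IsIntegralOf f g a b) (hab : a ≤ b)
    (hφ : ∀ x, HasDerivAt φ (φ' x) x) (hφ' : Continuous φ') :
    IsIntegralOf (fun x ↦ φ (f x)) (fun x ↦ φ' (f x) * g x) a b := by
  obtain ⟨C, hC⟩ := (h.absolutelyContinuousOnInterval hab).exists_bound
  have hφ1 : ContDiff ℝ 1 φ := by
    rw [contDiff_one_iff_deriv]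
    refine ⟨fun x ↦ (hφ x).differentiableAt, ?_⟩
    rwa [show deriv φ = φ' from funext fun x ↦ (hφ x).deriv]
  obtain ⟨K, hK⟩ := hφ1.contDiffOn.exists_lipschitzOnWith one_ne_zero
    (convex_Icc (-C) C) isCompact_Icc
  refine of_ae_hasDerivAt ((h.absolutelyContinuousOnInterval hab).lipschitzOnWith_comp hK
    fun x hx ↦ abs_le.1 (hC x hx)) ?_ hab
  filter_upwards [h.ae_hasDerivAt hab] with x hx hxm
  exact (hφ (f x)).comp x (hx hxm)

theorem const (c a b : ℝ) : IsIntegralOf (fun _ ↦ c) (fun _ ↦ 0) a b :=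
  ⟨by simp, by simp⟩

theorem integral (hg : IntervalIntegrable g volume a b) :
    IsIntegralOf (fun x ↦ ∫ t in a..x, g t) g a b :=
  ⟨hg, by simp⟩

theorem congr (h : IsIntegralOf f₁ g₁ a b) (hab : a ≤ b) (hf : EqOn f₁ f₂ (Icc a b))
    (hg : EqOn g₁ g₂ (Icc a b)) : IsIntegralOf f₂ g₂ a b := by
  refine ⟨h.intervalIntegrable.congr fun x hx ↦ hg ?_, fun x hx ↦ ?_⟩
  · rw [uIoc_of_le hab] at hx
    exact Ioc_subset_Icc_self hx
  · rw [← hf hx, ← hf (left_mem_Icc.2 hab), h.eq_add_integral x hx]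
    congr 1
    refine intervalIntegral.integral_congr fun t ht ↦ hg ?_
    rw [uIcc_of_le hx.1] at ht
    exact ⟨ht.1, ht.2.trans hx.2⟩

theorem sub_eq_integral (h : IsIntegralOf f g a b) {c d : ℝ} (hc : c ∈ Icc a b)
    (hd : d ∈ Icc a b) : f d - f c = ∫ t in c..d, g t := by
  have hi : ∀ x ∈ Icc a b, IntervalIntegrable g volume a x := fun x hx ↦
    h.intervalIntegrable.mono_set (by
      rw [uIcc_of_le hx.1, uIcc_of_le (hx.1.trans hx.2)]; exact Icc_subset_Icc_right hx.2)
  rw [h.eq_add_integral c hc, h.eq_add_integral d hd,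
    ← intervalIntegral.integral_interval_sub_left (hi d hd) (hi c hc)]
  ring

theorem mono (h : IsIntegralOf f g a b) {c d : ℝ} (hac : a ≤ c) (hcd : c ≤ d) (hdb : d ≤ b) :
    IsIntegralOf f g c d := by
  refine ⟨h.intervalIntegrable.mono_set ?_, fun x hx ↦ ?_⟩
  · rw [uIcc_of_le hcd, uIcc_of_le (hac.trans (hcd.trans hdb))]
    exact Icc_subset_Icc hac hdb
  · rw [← h.sub_eq_integral ⟨hac, hcd.trans hdb⟩ ⟨hac.trans hx.1, hx.2.trans hdb⟩]
    ring

/-- Variation of constants for the scalar linear equation `f' = m f + r`. -/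
theorem exp_neg_mul_eq {m r : ℝ → ℝ} (h : IsIntegralOf f (fun x ↦ m x * f x + r x) a b)
    (hab : a ≤ b) (hm : IntervalIntegrable m volume a b) :
    rexp (-∫ t in a..b, m t) * f b = f a + ∫ x in a..b, rexp (-∫ t in a..x, m t) * r x := by
  have hA := (((IsIntegralOf.integral hm).comp hab (φ := fun x ↦ rexp (-x))
    (φ' := fun x ↦ -rexp (-x)) (fun x ↦ by simpa using (hasDerivAt_neg x).exp)
    (by fun_prop)).mul h hab).eq_add_integral b (right_mem_Icc.2 hab)
  simp only [intervalIntegral.integral_same, neg_zero, Real.exp_zero, one_mul] at hA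
  rw [hA]
  congr 1
  refine intervalIntegral.integral_congr fun x _ ↦ ?_
  ring

/-- A solution of `f' = m f + r` with `f a ≥ 0`, `r ≥ 0` continuous and somewhere positive is
positive at `b`. -/
theorem pos_of_linear {m r : ℝ → ℝ} (h : IsIntegralOf f (fun x ↦ m x * f x + r x) a b)
    (hab : a < b) (hm : IntervalIntegrable m volume a b) (hr : ContinuousOn r (Icc a b))
    (hr0 : ∀ x ∈ Icc a b, 0 ≤ r x) (hr1 : ∃ x ∈ Icc a b, 0 < r x) (hfa : 0 ≤ f a) : 0 < f b := by
  have h1 := h.exp_neg_mul_eq hab.le hm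
  have h2 : 0 < ∫ x in a..b, rexp (-∫ t in a..x, m t) * r x := by
    obtain ⟨c, hc, hc'⟩ := hr1
    refine intervalIntegral.integral_pos hab ?_
      (fun x hx ↦ mul_nonneg (Real.exp_pos _).le (hr0 x (Ioc_subset_Icc_self hx)))
      ⟨c, hc, mul_pos (Real.exp_pos _) hc'⟩
    exact (((IsIntegralOf.integral hm).continuousOn hab.le).neg.rexp).mul hr
  have h3 : 0 < rexp (-∫ t in a..b, m t) * f b := by rw [h1]; linarith
  exact (mul_pos_iff_of_pos_left (Real.exp_pos _)).1 h3

/-- A Grönwall bound for `f' = m f + r`, `f a = 0`. -/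
theorem abs_le_of_linear {m r k : ℝ → ℝ} {C : ℝ}
    (h : IsIntegralOf f (fun x ↦ m x * f x + r x) a b) (hab : a ≤ b)
    (hm : IntervalIntegrable m volume a b) (hk : IntervalIntegrable k volume a b)
    (hmk : ∀ x ∈ Icc a b, |m x| ≤ k x) (hr : ∀ x ∈ Icc a b, |r x| ≤ C) (hfa : f a = 0) :
    |f b| ≤ rexp (2 * ∫ x in a..b, k x) * (C * (b - a)) := by
  have h1 := h.exp_neg_mul_eq hab hm
  set N := ∫ x in a..b, k x
  have hA : ∀ x ∈ Icc a b, |∫ t in a..x, m t| ≤ N := by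
    intro x hx
    have hsub : uIcc a x ⊆ uIcc a b := by
      rw [uIcc_of_le hab, uIcc_of_le hx.1]; exact Icc_subset_Icc_right hx.2
    have hsub' : uIcc x b ⊆ uIcc a b := by
      rw [uIcc_of_le hab, uIcc_of_le hx.2]; exact Icc_subset_Icc_left hx.1
    have h2 : ‖∫ t in a..x, m t‖ ≤ ∫ t in a..x, k t :=
      intervalIntegral.norm_integral_le_of_norm_le hx.1
        (.of_forall fun t ht ↦ hmk t ⟨ht.1.le, ht.2.trans hx.2⟩) (hk.mono_set hsub)
    have h3 : 0 ≤ ∫ t in x..b, k t := intervalIntegral.integral_nonneg hx.2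
      fun t ht ↦ (abs_nonneg _).trans (hmk t ⟨hx.1.trans ht.1, ht.2⟩)
    have h4 := intervalIntegral.integral_add_adjacent_intervals (hk.mono_set hsub)
      (hk.mono_set hsub')
    rw [Real.norm_eq_abs] at h2
    linarith
  have h2 : ‖∫ x in a..b, rexp (-∫ t in a..x, m t) * r x‖ ≤ rexp N * C * |b - a| := by
    refine intervalIntegral.norm_integral_le_of_norm_le_const fun x hx ↦ ?_
    rw [uIoc_of_le hab] at hx
    rw [norm_mul, Real.norm_of_nonneg (Real.exp_pos _).le]
    refine mul_le_mul (Real.exp_le_exp.2 ?_) (hr x (Ioc_subset_Icc_self hx)) (norm_nonneg _)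
      (Real.exp_pos _).le
    linarith [abs_le.1 (hA x (Ioc_subset_Icc_self hx))]
  rw [hfa, zero_add] at h1
  have h3 : f b = rexp (∫ t in a..b, m t) * ∫ x in a..b, rexp (-∫ t in a..x, m t) * r x := by
    rw [← h1, ← mul_assoc, ← Real.exp_add]; simp
  rw [h3, abs_mul, abs_of_pos (Real.exp_pos _), two_mul, Real.exp_add, mul_assoc]
  refine mul_le_mul (Real.exp_le_exp.2 ?_) ?_ (abs_nonneg _) (Real.exp_pos _).le
  · exact (le_abs_self _).trans (hA b (right_mem_Icc.2 hab))
  · rw [abs_of_nonneg (sub_nonneg.2 hab), Real.norm_eq_abs] at h2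
    linarith

end IsIntegralOf

theorem IntervalIntegrable.mul_continuousOn_Icc {f g : ℝ → ℝ} {a b : ℝ}
    (hf : IntervalIntegrable f volume a b) (hab : a ≤ b) (hg : ContinuousOn g (Icc a b)) :
    IntervalIntegrable (fun x ↦ f x * g x) volume a b :=
  hf.mul_continuousOn (by rwa [uIcc_of_le hab])

theorem Real.sin_sq_sub_sin_sq (u v : ℝ) : sin u ^ 2 - sin v ^ 2 = sin (u - v) * sin (u + v) := by
  rw [sin_sub, sin_add]
  linear_combination sin v ^ 2 * sin_sq_add_cos_sq u - sin u ^ 2 * sin_sq_add_cos_sq v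

theorem Real.abs_sin_sq_sub_sin_sq_le (u v : ℝ) : |sin u ^ 2 - sin v ^ 2| ≤ |u - v| := by
  rw [sin_sq_sub_sin_sq, abs_mul]
  calc |sin (u - v)| * |sin (u + v)| ≤ |u - v| * 1 :=
        mul_le_mul abs_sin_le_abs (abs_sin_le_one _) (abs_nonneg _) (abs_nonneg _)
    _ = |u - v| := mul_one _

theorem Real.sinc_mul_self (x : ℝ) : sinc x * x = sin x := by
  rcases eq_or_ne x 0 with rfl | hx
  · simp
  · rw [sinc_of_ne_zero hx, div_mul_cancel₀ _ hx]

/-- The Prüfer equation `θ' = 1 + p sin² θ` on `[a, b]`. -/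
def IsPruferAngle (p θ : ℝ → ℝ) (a b : ℝ) : Prop :=
  IsIntegralOf θ (fun x ↦ 1 + p x * sin (θ x) ^ 2) a b

/-- Carathéodory existence for the Prüfer equation, by contraction in a weighted sup norm. -/
theorem exists_isPruferAngle {p : ℝ → ℝ} {a b : ℝ} (hab : a ≤ b)
    (hp : IntervalIntegrable p volume a b) (θ₀ : ℝ) :
    ∃ θ, θ a = θ₀ ∧ IsPruferAngle p θ a b := by
  set P : ℝ → ℝ := fun x ↦ ∫ t in a..x, |p t|
  have hP : ContinuousOn P (Icc a b) := (IsIntegralOf.integral hp.abs).continuousOn hab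
  have hE : IsIntegralOf (fun x ↦ rexp (2 * P x)) (fun x ↦ 2 * rexp (2 * P x) * |p x|) a b :=
    (IsIntegralOf.integral hp.abs).comp hab (φ := fun x ↦ rexp (2 * x))
      (φ' := fun x ↦ 2 * rexp (2 * x))
      (fun x ↦ by simpa [mul_comm] using ((hasDerivAt_id x).const_mul 2).exp) (by fun_prop)
  set U : C(Icc a b, ℝ) → ℝ → ℝ := fun v x ↦ rexp (2 * P x) * IccExtend hab v x
  have hU : ∀ v, ContinuousOn (U v) (Icc a b) := fun v ↦
    (hE.continuousOn hab).mul (v.continuous.Icc_extend' (h := hab)).continuousOn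
  have hI : ∀ v, IntervalIntegrable (fun t ↦ 1 + p t * sin (U v t) ^ 2) volume a b := by
    intro v
    refine intervalIntegrable_const.add (hp.mul_continuousOn ?_)
    rw [uIcc_of_le hab]
    exact (continuous_sin.comp_continuousOn (hU v)).pow 2
  set G : C(Icc a b, ℝ) → ℝ → ℝ := fun v x ↦ θ₀ + ∫ t in a..x, (1 + p t * sin (U v t) ^ 2)
  have hG : ∀ v, ContinuousOn (G v) (Icc a b) := fun v ↦
    continuousOn_const.add ((IsIntegralOf.integral (hI v)).continuousOn hab)
  have hsub : ∀ x ∈ Icc a b, uIcc a x ⊆ uIcc a b := fun x hx ↦ by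
    rw [uIcc_of_le hab, uIcc_of_le hx.1]; exact Icc_subset_Icc_right hx.2
  let S : C(Icc a b, ℝ) → C(Icc a b, ℝ) := fun v ↦
    ⟨(Icc a b).domRestrict fun x ↦ rexp (-(2 * P x)) * G v x,
      (((continuousOn_const.mul hP).neg.rexp).mul (hG v)).domRestrict⟩
  have hS : ContractingWith (1 / 2) S := by
    refine ⟨by norm_num, LipschitzWith.of_dist_le_mul fun v w ↦ ?_⟩
    rw [ContinuousMap.dist_le (by positivity)]
    intro x
    have hx := x.2
    have h1 : ‖∫ t in a..(x : ℝ), ((1 + p t * sin (U v t) ^ 2) - (1 + p t * sin (U w t) ^ 2))‖ ≤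
        ∫ t in a..(x : ℝ), dist v w / 2 * (2 * rexp (2 * P t) * |p t|) := by
      refine intervalIntegral.norm_integral_le_of_norm_le hx.1 (.of_forall fun t ht ↦ ?_)
        ((hE.intervalIntegrable.mono_set (hsub x hx)).const_mul _)
      have h2 : |U v t - U w t| ≤ rexp (2 * P t) * dist v w := by
        rw [← mul_sub, abs_mul, abs_of_pos (Real.exp_pos _)]
        exact mul_le_mul_of_nonneg_left
          (ContinuousMap.dist_apply_le_dist (f := v) (g := w) _) (Real.exp_pos _).le
      rw [add_sub_add_left_eq_sub, ← mul_sub, norm_mul, Real.norm_eq_abs, Real.norm_eq_abs]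
      have h3 := mul_le_mul_of_nonneg_left
        ((abs_sin_sq_sub_sin_sq_le (U v t) (U w t)).trans h2) (abs_nonneg (p t))
      linarith
    rw [intervalIntegral.integral_sub ((hI v).mono_set (hsub x hx))
      ((hI w).mono_set (hsub x hx)), intervalIntegral.integral_const_mul] at h1
    have h4 := hE.eq_add_integral x hx
    have h5 : P a = 0 := intervalIntegral.integral_same
    rw [h5, mul_zero, Real.exp_zero] at h4
    have h6 : |G v x - G w x| ≤ dist v w / 2 * rexp (2 * P x) := by
      rw [Real.norm_eq_abs] at h1
      simp only [G, add_sub_add_left_eq_sub]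
      nlinarith [dist_nonneg (x := v) (y := w)]
    change |rexp (-(2 * P x)) * G v x - rexp (-(2 * P x)) * G w x| ≤ _
    rw [← mul_sub, abs_mul, abs_of_pos (Real.exp_pos _)]
    calc rexp (-(2 * P x)) * |G v x - G w x|
        ≤ rexp (-(2 * P x)) * (dist v w / 2 * rexp (2 * P x)) :=
          mul_le_mul_of_nonneg_left h6 (Real.exp_pos _).le
      _ = dist v w / 2 * (rexp (-(2 * P x)) * rexp (2 * P x)) := by ring
      _ = dist v w / 2 := by rw [← Real.exp_add]; simp
      _ = _ := by push_cast; ring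
  have : Nonempty (C(Icc a b, ℝ)) := ⟨0⟩
  obtain ⟨v, hv⟩ : ∃ v, S v = v := ⟨_, hS.fixedPoint_isFixedPt⟩
  have hUG : EqOn (U v) (G v) (Icc a b) := by
    intro x hx
    have h1 : rexp (-(2 * P x)) * G v x = v ⟨x, hx⟩ := DFunLike.congr_fun hv ⟨x, hx⟩
    simp only [U]
    rw [IccExtend_of_mem hab v hx, ← h1, ← mul_assoc, ← Real.exp_add]
    simp
  have ha : G v a = θ₀ := by simp [G]
  refine ⟨G v, ha, ?_⟩
  have h1 : IsIntegralOf (G v) (fun t ↦ 1 + p t * sin (U v t) ^ 2) a b :=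
    ⟨hI v, fun x _ ↦ by rw [ha]⟩
  refine h1.congr hab (fun _ _ ↦ rfl) fun x hx ↦ ?_
  simp only [hUG hx]

namespace IsPruferAngle

variable {p p₁ p₂ θ θ₁ θ₂ : ℝ → ℝ} {a b : ℝ}

theorem continuousOn (h : IsPruferAngle p θ a b) (hab : a ≤ b) : ContinuousOn θ (Icc a b) :=
  IsIntegralOf.continuousOn h hab

theorem mono (h : IsPruferAngle p θ a b) {c d : ℝ} (hac : a ≤ c) (hcd : c ≤ d) (hdb : d ≤ b) :
    IsPruferAngle p θ c d :=
  IsIntegralOf.mono h hac hcd hdb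

/-- The difference of two Prüfer angles solves a linear equation. -/
theorem sub_linear (h₁ : IsPruferAngle p₁ θ₁ a b) (h₂ : IsPruferAngle p₂ θ₂ a b) (hab : a ≤ b) :
    IsIntegralOf (fun x ↦ θ₂ x - θ₁ x)
      (fun x ↦ (p₂ x * (sinc (θ₂ x - θ₁ x) * sin (θ₂ x + θ₁ x))) * (θ₂ x - θ₁ x) +
        (p₂ x - p₁ x) * sin (θ₁ x) ^ 2) a b := by
  refine (IsIntegralOf.sub h₂ h₁ hab).congr hab (fun _ _ ↦ rfl) fun x _ ↦ ?_
  have h1 := sinc_mul_self (θ₂ x - θ₁ x)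
  have h2 := sin_sq_sub_sin_sq (θ₂ x) (θ₁ x)
  simp only
  linear_combination p₂ x * h2 - p₂ x * sin (θ₂ x + θ₁ x) * h1

theorem continuousOn_coeff (h₁ : ContinuousOn θ₁ (Icc a b)) (h₂ : ContinuousOn θ₂ (Icc a b)) :
    ContinuousOn (fun x ↦ sinc (θ₂ x - θ₁ x) * sin (θ₂ x + θ₁ x)) (Icc a b) :=
  (continuous_sinc.comp_continuousOn (h₂.sub h₁)).mul
    (continuous_sin.comp_continuousOn (h₂.add h₁))

/-- A Prüfer angle crosses every multiple of `π` strictly upwards. -/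
theorem lt_of_le_int_mul_pi (h : IsPruferAngle p θ a b) (hp : IntervalIntegrable p volume a b)
    {c d : ℝ} (hac : a ≤ c) (hcd : c < d) (hdb : d ≤ b) (k : ℤ) (hk : k * π ≤ θ c) :
    k * π < θ d := by
  have hab : a ≤ b := hac.trans (hcd.le.trans hdb)
  have h' := h.mono hac hcd.le hdb
  have hp' : IntervalIntegrable p volume c d := hp.mono_set (by
    rw [uIcc_of_le hcd.le, uIcc_of_le hab]; exact Icc_subset_Icc hac hdb)
  have hc : ContinuousOn (fun x ↦ θ x - k * π) (Icc c d) :=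
    (h'.continuousOn hcd.le).sub continuousOn_const
  have h1 : IsIntegralOf (fun x ↦ θ x - k * π)
      (fun x ↦ (p x * (sinc (θ x - k * π) * sin (θ x - k * π))) * (θ x - k * π) + 1) c d := by
    refine (IsIntegralOf.sub h' (IsIntegralOf.const (k * π) c d) hcd.le).congr hcd.le
      (fun _ _ ↦ rfl) fun x _ ↦ ?_
    have h1 := sinc_mul_self (θ x - k * π)
    have h2 : sin (θ x) ^ 2 = sin (θ x - k * π) ^ 2 := by
      rw [← sub_eq_zero, sin_sq_sub_sin_sq, sub_sub_cancel, sin_int_mul_pi, zero_mul]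
    simp only [h2]
    linear_combination -p x * sin (θ x - k * π) * h1
  have h2 := h1.pos_of_linear hcd (hp'.mul_continuousOn_Icc hcd.le
    ((continuous_sinc.comp_continuousOn hc).mul (continuous_sin.comp_continuousOn hc)))
    continuousOn_const (fun _ _ ↦ zero_le_one) ⟨c, left_mem_Icc.2 hcd.le, one_pos⟩
    (sub_nonneg.2 hk)
  exact sub_pos.1 h2

theorem exists_sin_ne_zero (h : IsPruferAngle p θ a b) (hab : a < b) :
    ∃ x ∈ Icc a b, sin (θ x) ≠ 0 := by
  by_contra! H
  have hx : a + min (b - a) 1 ∈ Icc a b :=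
    ⟨le_add_of_nonneg_right (le_min (sub_pos.2 hab).le zero_le_one),
      by linarith [min_le_left (b - a) 1]⟩
  have h1 : θ (a + min (b - a) 1) = θ a + min (b - a) 1 := by
    rw [h.eq_add_integral _ hx]
    have : ∫ t in a..(a + min (b - a) 1), (1 + p t * sin (θ t) ^ 2) =
        ∫ _ in a..(a + min (b - a) 1), (1 : ℝ) := by
      refine intervalIntegral.integral_congr fun t ht ↦ ?_
      rw [uIcc_of_le hx.1] at ht
      simp [H t ⟨ht.1, ht.2.trans hx.2⟩]
    rw [this]
    simp
  have h2 := H _ hx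
  have h3 := H a (left_mem_Icc.2 hab.le)
  rw [h1, sin_add, h3, zero_mul, zero_add] at h2
  have h4 : 0 < sin (min (b - a) 1) :=
    sin_pos_of_pos_of_lt_pi (lt_min (sub_pos.2 hab) one_pos)
      ((min_le_right _ _).trans_lt (by linarith [pi_gt_three]))
  have h5 := (mul_eq_zero.1 h2).resolve_right h4.ne'
  simpa [h3, h5] using sin_sq_add_cos_sq (θ a)

/-- Sturm comparison: the Prüfer angle is strictly increasing in the spectral parameter. -/
theorem lt_of_add_const {δ : ℝ} (h₁ : IsPruferAngle p θ₁ a b)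
    (h₂ : IsPruferAngle (fun x ↦ p x + δ) θ₂ a b) (hab : a < b)
    (hp : IntervalIntegrable p volume a b) (hδ : 0 < δ) (h0 : θ₁ a = θ₂ a) : θ₁ b < θ₂ b := by
  have hc₁ := h₁.continuousOn hab.le
  obtain ⟨x, hx, hx'⟩ := h₁.exists_sin_ne_zero hab
  refine sub_pos.1 ((h₁.sub_linear h₂ hab.le).pos_of_linear hab
    ((hp.add intervalIntegrable_const).mul_continuousOn_Icc hab.le
      (continuousOn_coeff hc₁ (h₂.continuousOn hab.le))) ?_ ?_ ⟨x, hx, ?_⟩ (by simp [h0]))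
  · simp only [add_sub_cancel_left]
    exact continuousOn_const.mul ((continuous_sin.comp_continuousOn hc₁).pow 2)
  · intro x _
    rw [add_sub_cancel_left]
    positivity
  · rw [add_sub_cancel_left]
    positivity

/-- The Prüfer angle depends Lipschitz continuously on the spectral parameter. -/
theorem abs_sub_le_of_add_const {δ : ℝ} (h₁ : IsPruferAngle (fun x ↦ p x + δ) θ₁ a b)
    (h₂ : IsPruferAngle p θ₂ a b) (hab : a ≤ b) (hp : IntervalIntegrable p volume a b)
    (h0 : θ₁ a = θ₂ a) :
    |θ₂ b - θ₁ b| ≤ rexp (2 * ∫ x in a..b, |p x|) * (|δ| * (b - a)) := by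
  refine (h₁.sub_linear h₂ hab).abs_le_of_linear hab
    (hp.mul_continuousOn_Icc hab
      (continuousOn_coeff (h₁.continuousOn hab) (h₂.continuousOn hab))) hp.abs ?_ ?_ (by simp [h0])
  · intro x _
    rw [abs_mul, abs_mul]
    exact mul_le_of_le_one_right (abs_nonneg _)
      (mul_le_one₀ (abs_sinc_le_one _) (abs_nonneg _) (abs_sin_le_one _))
  · intro x _
    rw [abs_mul, show p x - (p x + δ) = -δ by ring, abs_neg,
      abs_of_nonneg (sq_nonneg (sin (θ₁ x)))]
    exact mul_le_of_le_one_right (abs_nonneg _) (sin_sq_le_one _)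

end IsPruferAngle

theorem ContinuousOn.exists_upcrossing {f : ℝ → ℝ} {a b u v : ℝ} (hf : ContinuousOn f (Icc a b))
    (hab : a ≤ b) (hu : f a ≤ u) (hv : v ≤ f b) (huv : u < v) :
    ∃ c d, a ≤ c ∧ c < d ∧ d ≤ b ∧ f c = u ∧ f d = v ∧ ∀ x ∈ Icc c d, f x ∈ Icc u v := by
  obtain ⟨d, ⟨⟨had, hdb⟩, hd⟩, hdmin⟩ := (isCompact_Icc.of_isClosed_subset
    (hf.preimage_isClosed_of_isClosed isClosed_Icc isClosed_Ici)
    inter_subset_left).exists_isLeast ⟨b, right_mem_Icc.2 hab, hv⟩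
  have hf' : ContinuousOn f (Icc a d) := hf.mono (Icc_subset_Icc_right hdb)
  obtain ⟨c, ⟨⟨hac, hcd⟩, hc⟩, hcmax⟩ := (isCompact_Icc.of_isClosed_subset
    (hf'.preimage_isClosed_of_isClosed isClosed_Icc isClosed_Iic)
    inter_subset_left).exists_isGreatest ⟨a, left_mem_Icc.2 had, hu⟩
  have hd : v ≤ f d := hd
  have hc : f c ≤ u := hc
  have hfd : f d = v := by
    obtain ⟨x, hx, hxv⟩ := intermediate_value_Icc had hf' ⟨hu.trans huv.le, hd⟩
    have : d ≤ x := hdmin ⟨⟨hx.1, hx.2.trans hdb⟩, hxv.ge⟩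
    rwa [← le_antisymm hx.2 this] at *
  have hfc : f c = u := by
    obtain ⟨x, hx, hxu⟩ := intermediate_value_Icc hcd (hf'.mono (Icc_subset_Icc_left hac))
      ⟨hc, huv.le.trans hd⟩
    have : x ≤ c := hcmax ⟨⟨hac.trans hx.1, hx.2⟩, hxu.le⟩
    rwa [← le_antisymm this hx.1]
  refine ⟨c, d, hac, lt_of_le_of_ne hcd ?_, hdb, hfc, hfd, fun x hx ↦ ⟨?_, ?_⟩⟩
  · rintro rfl
    linarith
  · by_contra! h
    have : x ≤ c := hcmax ⟨⟨hac.trans hx.1, hx.2⟩, h.le⟩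
    rw [le_antisymm this hx.1] at h
    linarith
  · by_contra! h
    have : d ≤ x := hdmin ⟨⟨hac.trans hx.1, hx.2.trans hdb⟩, h.le⟩
    rw [le_antisymm hx.2 this] at h
    linarith

/-- The Prüfer angle at the right endpoint tends to `0` as the spectral parameter tends to
`-∞`. -/
theorem exists_forall_isPruferAngle_lt {q : ℝ → ℝ} {a b θ₀ ε : ℝ} (hab : a < b)
    (hq : IntervalIntegrable q volume a b) (h0 : 0 ≤ θ₀) (hπ : θ₀ < π) (hε : 0 < ε) :
    ∃ μ : ℝ, ∀ θ, IsPruferAngle (fun x ↦ μ - 1 - q x) θ a b → θ a = θ₀ → θ b < ε := by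
  obtain ⟨η, hη, hηε, hηπ⟩ : ∃ η > 0, 3 * η ≤ ε ∧ 4 * η ≤ π - θ₀ := by
    refine ⟨min (ε / 3) ((π - θ₀) / 4), lt_min (by linarith) (by linarith), ?_, ?_⟩
    · linarith [min_le_left (ε / 3) ((π - θ₀) / 4)]
    · linarith [min_le_right (ε / 3) ((π - θ₀) / 4)]
  have hQ : IntervalIntegrable (fun x ↦ 1 + |q x|) volume a b := intervalIntegrable_const.add hq.abs
  set G : ℝ → ℝ := fun x ↦ ∫ t in a..x, (1 + |q t|)
  have hG : IsIntegralOf G (fun x ↦ 1 + |q x|) a b := IsIntegralOf.integral hQ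
  have hGmono : ∀ c ∈ Icc a b, ∀ d ∈ Icc a b, c ≤ d → G c ≤ G d := fun c hc d hd hcd ↦ by
    rw [← sub_nonneg, hG.sub_eq_integral hc hd]
    exact intervalIntegral.integral_nonneg hcd fun x _ ↦ by positivity
  have hGa : G a = 0 := intervalIntegral.integral_same
  have ha : a ∈ Icc a b := left_mem_Icc.2 hab.le
  have hb : b ∈ Icc a b := right_mem_Icc.2 hab.le
  obtain ⟨δ, hδ, hGδ⟩ := Metric.uniformContinuousOn_iff.1
    (isCompact_Icc.uniformContinuousOn_of_continuous (hG.continuousOn hab.le)) η hη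
  have hGb : 0 ≤ G b := hGa ▸ hGmono a ha b hb hab.le
  have hκ : 0 < sin η := sin_pos_of_pos_of_lt_pi hη (by linarith)
  set δ' := min δ (b - a)
  have hδ' : 0 < δ' := lt_min hδ (sub_pos.2 hab)
  set μ := -((G b + π + 1) / (sin η ^ 2 * δ'))
  have hμ : μ * sin η ^ 2 * δ' = -(G b + π + 1) := by simp only [μ]; field_simp
  have hμ0 : μ ≤ 0 := by
    have := pi_pos
    exact neg_nonpos.2 (by positivity)
  refine ⟨μ, fun θ hθ hθa ↦ ?_⟩
  have growth : ∀ c ∈ Icc a b, ∀ d ∈ Icc a b, c ≤ d → (∀ x ∈ Icc c d, θ x ∈ Icc η (π - η)) →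
      θ d - θ c ≤ G d - G c + μ * sin η ^ 2 * (d - c) := by
    intro c hc d hd hcd h
    have h1 := hθ.mono hc.1 hcd hd.2
    have h2 := hG.mono hc.1 hcd hd.2
    rw [hG.sub_eq_integral hc hd, IsIntegralOf.sub_eq_integral hθ hc hd]
    have h3 : ∫ t in c..d, (1 + (μ - 1 - q t) * sin (θ t) ^ 2) ≤
        ∫ t in c..d, ((1 + |q t|) + μ * sin η ^ 2) := by
      refine intervalIntegral.integral_mono_on hcd h1.intervalIntegrable
        (h2.intervalIntegrable.add intervalIntegrable_const) fun x hx ↦ ?_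
      have h4 : sin η ≤ sin (θ x) := by
        obtain ⟨h5, h6⟩ := h x hx
        rcases le_total (θ x) (π / 2) with h7 | h7
        · exact sin_le_sin_of_le_of_le_pi_div_two (by linarith) h7 h5
        · rw [← sin_pi_sub (θ x)]
          exact sin_le_sin_of_le_of_le_pi_div_two (by linarith) (by linarith) (by linarith)
      have h5 : sin η ^ 2 ≤ sin (θ x) ^ 2 := pow_le_pow_left₀ hκ.le h4 2
      nlinarith [sin_sq_le_one (θ x), sq_nonneg (sin (θ x)), neg_abs_le (q x), abs_nonneg (q x)]
    rw [intervalIntegral.integral_add h2.intervalIntegrable intervalIntegrable_const,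
      intervalIntegral.integral_const, smul_eq_mul] at h3
    linarith
  have no_upcrossing : ∀ u, η ≤ u → u + 2 * η ≤ π - η → ∀ c ∈ Icc a b, ∀ d ∈ Icc a b, c ≤ d →
      θ c ≤ u → θ d < u + 2 * η := by
    intro u hu1 hu2 c hc d hd hcd hcu
    by_contra! hdu
    obtain ⟨c', d', hcc, hcd', hdd, hc', hd', hm⟩ :=
      ((hθ.mono hc.1 hcd hd.2).continuousOn hcd).exists_upcrossing hcd hcu hdu (by linarith)
    have hcm : c' ∈ Icc a b := ⟨hc.1.trans hcc, hcd'.le.trans (hdd.trans hd.2)⟩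
    have hdm : d' ∈ Icc a b := ⟨hcm.1.trans hcd'.le, hdd.trans hd.2⟩
    have h1 := growth c' hcm d' hdm hcd'.le fun x hx ↦
      ⟨hu1.trans (hm x hx).1, (hm x hx).2.trans hu2⟩
    rw [hc', hd'] at h1
    rcases lt_or_ge (d' - c') δ with h2 | h2
    · have h3 := hGδ d' hdm c' hcm (by rwa [Real.dist_eq, abs_of_pos (sub_pos.2 hcd')])
      rw [Real.dist_eq] at h3
      have h4 : μ * sin η ^ 2 * (d' - c') ≤ 0 := mul_nonpos_of_nonpos_of_nonneg
        (mul_nonpos_of_nonpos_of_nonneg hμ0 (sq_nonneg _)) (sub_nonneg.2 hcd'.le)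
      linarith [le_abs_self (G d' - G c')]
    · have h3 : μ * sin η ^ 2 * (d' - c') ≤ μ * sin η ^ 2 * δ' := mul_le_mul_of_nonpos_left
        ((min_le_left _ _).trans h2) (mul_nonpos_of_nonpos_of_nonneg hμ0 (sq_nonneg _))
      linarith [hGmono a ha c' hcm hcm.1, hGmono d' hdm b hb hdm.2, pi_pos]
  have upper : ∀ x ∈ Icc a b, θ x < π - η := fun x hx ↦ by
    have := no_upcrossing (π - 3 * η) (by linarith) (by linarith) a ha x hx hx.1 (by linarith)
    linarith
  obtain ⟨c, hc, hcη⟩ : ∃ c ∈ Icc a b, θ c ≤ η := by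
    by_contra! H
    have h1 := growth a ha b hb hab.le fun x hx ↦ ⟨(H x hx).le, (upper x hx).le⟩
    have h2 : μ * sin η ^ 2 * (b - a) ≤ μ * sin η ^ 2 * δ' := mul_le_mul_of_nonpos_left
      (min_le_right _ _) (mul_nonpos_of_nonpos_of_nonneg hμ0 (sq_nonneg _))
    linarith [H b hb, pi_pos]
  have := no_upcrossing η le_rfl (by linarith) c hc b hb hc.2 hcη
  linarith

/-- A Prüfer angle starting in `[0, π)` and ending in `(k π, (k + 1) π]` meets `π ℤ` exactly `k`
times in between. -/
theorem IsPruferAngle.ncard_zeros {p θ : ℝ → ℝ} {a b : ℝ} (h : IsPruferAngle p θ a b) (hab : a ≤ b)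
    (hp : IntervalIntegrable p volume a b) (h0 : 0 ≤ θ a) (hπ : θ a < π) {k : ℕ}
    (hk : k * π < θ b) (hk' : θ b ≤ (k + 1) * π) :
    {x ∈ Ioo a b | sin (θ x) = 0}.ncard = k := by
  have hex : ∀ j ∈ Finset.Icc 1 k, ∃ x ∈ Ioo a b, θ x = j * π := by
    intro j hj
    rw [Finset.mem_Icc] at hj
    have h1 : (1 : ℝ) ≤ j := by exact_mod_cast hj.1
    have h2 : (j : ℝ) ≤ k := by exact_mod_cast hj.2
    exact intermediate_value_Ioo hab (h.continuousOn hab)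
      ⟨by nlinarith [pi_pos], by nlinarith [pi_pos]⟩
  choose! X hX hθX using hex
  have hset : {x ∈ Ioo a b | sin (θ x) = 0} = X '' (Finset.Icc 1 k : Finset ℕ) := by
    ext x
    constructor
    · rintro ⟨hx, hs⟩
      obtain ⟨j, hj⟩ := sin_eq_zero_iff.1 hs
      have h1 : ((0 : ℤ) : ℝ) * π < θ x :=
        h.lt_of_le_int_mul_pi hp le_rfl hx.1 hx.2.le 0 (by simpa using h0)
      have h2 : j * π < θ b := h.lt_of_le_int_mul_pi hp hx.1.le hx.2 le_rfl j hj.le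
      rw [← hj] at h1
      have h3 : 0 < j := by exact_mod_cast lt_of_mul_lt_mul_right h1 pi_pos.le
      have h4 : j < k + 1 := by
        exact_mod_cast lt_of_mul_lt_mul_right (h2.trans_le hk') pi_pos.le
      lift j to ℕ using h3.le
      have hjk : j ∈ Finset.Icc 1 k := by rw [Finset.mem_Icc]; omega
      refine ⟨j, by exact_mod_cast hjk, ?_⟩
      have h5 : θ (X j) = j * π := hθX j hjk
      have h6 : (j : ℝ) * π = θ x := by simpa using hj
      rcases lt_trichotomy (X j) x with h7 | h7 | h7
      · have := h.lt_of_le_int_mul_pi hp (hX j hjk).1.le h7 hx.2.le j (by simp [h5])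
        rw [← h6] at this
        simp at this
      · exact h7
      · have := h.lt_of_le_int_mul_pi hp hx.1.le h7 (hX j hjk).2.le j (by simp [h6])
        rw [h5] at this
        simp at this
    · rintro ⟨j, hj, rfl⟩
      have hj : j ∈ Finset.Icc 1 k := by exact_mod_cast hj
      refine ⟨hX j hj, ?_⟩
      rw [hθX j hj, sin_nat_mul_pi]
  rw [hset, Set.InjOn.ncard_image, Set.ncard_coe_finset]
  · simp
  · intro i hi j hj hij
    have hi : i ∈ Finset.Icc 1 k := by exact_mod_cast hi
    have hj : j ∈ Finset.Icc 1 k := by exact_mod_cast hj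
    have := hθX i hi
    rw [hij, hθX j hj] at this
    exact_mod_cast (mul_right_cancel₀ pi_ne_zero this).symm

section Prufer

variable {q y y' θ : ℝ → ℝ} {μ : ℝ}

theorem IntervalIntegrable.const_sub_const_sub {a b : ℝ} (hq : IntervalIntegrable q volume a b)
    (μ : ℝ) : IntervalIntegrable (fun x ↦ μ - 1 - q x) volume a b :=
  intervalIntegrable_const.sub hq

theorem SLSol.isIntegralOf (h : SLSol q μ y y') (hq : IntervalIntegrable q volume 0 π) :
    IsIntegralOf y y' 0 π ∧ IsIntegralOf y' (fun x ↦ (q x - μ) * y x) 0 π :=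
  ⟨⟨h.2.1.intervalIntegrable_of_Icc pi_pos.le, h.2.2.1⟩,
    ⟨(hq.sub intervalIntegrable_const).mul_continuousOn_Icc pi_pos.le h.1, h.2.2.2⟩⟩

theorem IsPruferAngle.comp_sin (h : IsPruferAngle (fun x ↦ μ - 1 - q x) θ 0 π) :
    IsIntegralOf (fun x ↦ sin (θ x))
      (fun x ↦ cos (θ x) * (1 + (μ - 1 - q x) * sin (θ x) ^ 2)) 0 π :=
  IsIntegralOf.comp h pi_pos.le hasDerivAt_sin continuous_cos

theorem IsPruferAngle.comp_cos (h : IsPruferAngle (fun x ↦ μ - 1 - q x) θ 0 π) :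
    IsIntegralOf (fun x ↦ cos (θ x))
      (fun x ↦ -sin (θ x) * (1 + (μ - 1 - q x) * sin (θ x) ^ 2)) 0 π :=
  IsIntegralOf.comp h pi_pos.le hasDerivAt_cos continuous_sin.neg

theorem IsPruferAngle.intervalIntegrable_coeff (h : IsPruferAngle (fun x ↦ μ - 1 - q x) θ 0 π)
    (hq : IntervalIntegrable q volume 0 π) :
    IntervalIntegrable (fun x ↦ (μ - 1 - q x) * -(sin (θ x) * cos (θ x))) volume 0 π := by
  have hθ := h.continuousOn pi_pos.le
  exact (hq.const_sub_const_sub μ).mul_continuousOn_Icc pi_pos.le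
    ((continuous_sin.comp_continuousOn hθ).mul (continuous_cos.comp_continuousOn hθ)).neg

/-- A nontrivial solution whose initial data points in the direction of the Prüfer angle `θ` is of
the form `y = R sin θ`, `y' = R cos θ` with `R` nowhere zero. -/
theorem SLSol.exists_polar (h : SLSol q μ y y') (hq : IntervalIntegrable q volume 0 π)
    (hθ : IsPruferAngle (fun x ↦ μ - 1 - q x) θ 0 π) (hy : ∃ x ∈ Icc 0 π, y x ≠ 0)
    (h0 : y 0 * cos (θ 0) = y' 0 * sin (θ 0)) :
    ∃ R : ℝ → ℝ, ∀ x ∈ Icc 0 π, R x ≠ 0 ∧ y x = R x * sin (θ x) ∧ y' x = R x * cos (θ x) := by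
  obtain ⟨hy1, hy2⟩ := h.isIntegralOf hq
  have hs := hθ.comp_sin
  have hc := hθ.comp_cos
  have hm := hθ.intervalIntegrable_coeff hq
  have hsub {x : ℝ} (hx : x ∈ Icc 0 π) : uIcc 0 x ⊆ uIcc 0 π := by
    rw [uIcc_of_le hx.1, uIcc_of_le pi_pos.le]; exact Icc_subset_Icc_right hx.2
  have hW : ∀ x ∈ Icc 0 π, y x * cos (θ x) - y' x * sin (θ x) = 0 := by
    have hW1 : IsIntegralOf (fun x ↦ y x * cos (θ x) - y' x * sin (θ x))
        (fun x ↦ -((μ - 1 - q x) * -(sin (θ x) * cos (θ x))) *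
          (y x * cos (θ x) - y' x * sin (θ x)) + 0) 0 π := by
      refine ((hy1.mul hc pi_pos.le).sub (hy2.mul hs pi_pos.le) pi_pos.le).congr pi_pos.le
        (fun _ _ ↦ rfl) fun x _ ↦ ?_
      simp only
      linear_combination -y x * sin (θ x) * (μ - 1 - q x) * sin_sq_add_cos_sq (θ x)
    intro x hx
    have h1 := (hW1.mono le_rfl hx.1 hx.2).exp_neg_mul_eq hx.1 (hm.neg.mono_set (hsub hx))
    simp only [mul_zero, intervalIntegral.integral_zero, add_zero, sub_eq_zero.2 h0] at h1
    exact (mul_eq_zero.1 h1).resolve_left (Real.exp_pos _).ne'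
  set R : ℝ → ℝ := fun x ↦ y x * sin (θ x) + y' x * cos (θ x)
  have hyR : ∀ x ∈ Icc 0 π, y x = R x * sin (θ x) ∧ y' x = R x * cos (θ x) := by
    intro x hx
    have h1 := hW x hx
    have h2 := sin_sq_add_cos_sq (θ x)
    constructor
    · linear_combination cos (θ x) * h1 - y x * h2
    · linear_combination -sin (θ x) * h1 - y' x * h2
  have hR : IsIntegralOf R (fun x ↦ ((μ - 1 - q x) * -(sin (θ x) * cos (θ x))) * R x + 0) 0 π := by
    refine ((hy1.mul hs pi_pos.le).add (hy2.mul hc pi_pos.le) pi_pos.le).congr pi_pos.le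
      (fun _ _ ↦ rfl) fun x hx ↦ ?_
    obtain ⟨h1, h2⟩ := hyR x hx
    simp only
    rw [h1, h2]
    ring
  have hR' : ∀ x ∈ Icc 0 π, (R x = 0 ↔ R 0 = 0) := by
    intro x hx
    have h1 := (hR.mono le_rfl hx.1 hx.2).exp_neg_mul_eq hx.1 (hm.mono_set (hsub hx))
    simp only [mul_zero, intervalIntegral.integral_zero, add_zero] at h1
    rw [← h1, mul_eq_zero_iff_left (Real.exp_pos _).ne']
  obtain ⟨x₀, hx₀, hyx₀⟩ := hy
  refine ⟨R, fun x hx ↦ ⟨?_, hyR x hx⟩⟩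
  rw [ne_eq, hR' x hx, ← hR' x₀ hx₀]
  intro h1
  exact hyx₀ (by rw [(hyR x₀ hx₀).1, h1, zero_mul])

/-- Every Prüfer angle is the angle of some solution. -/
theorem IsPruferAngle.exists_SLSol (hθ : IsPruferAngle (fun x ↦ μ - 1 - q x) θ 0 π)
    (hq : IntervalIntegrable q volume 0 π) :
    ∃ R : ℝ → ℝ, (∀ x, R x ≠ 0) ∧
      SLSol q μ (fun x ↦ R x * sin (θ x)) (fun x ↦ R x * cos (θ x)) := by
  have hR := (IsIntegralOf.integral (hθ.intervalIntegrable_coeff hq)).comp pi_pos.le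
    Real.hasDerivAt_exp Real.continuous_exp
  refine ⟨fun x ↦ rexp (∫ t in 0..x, (μ - 1 - q t) * -(sin (θ t) * cos (θ t))),
    fun x ↦ Real.exp_ne_zero _, ?_⟩
  have h1 := (hR.mul hθ.comp_sin pi_pos.le).congr pi_pos.le (fun _ _ ↦ rfl)
    (g₂ := fun x ↦ rexp (∫ t in 0..x, (μ - 1 - q t) * -(sin (θ t) * cos (θ t))) * cos (θ x))
    fun x _ ↦ by ring
  have h2 := (hR.mul hθ.comp_cos pi_pos.le).congr pi_pos.le (fun _ _ ↦ rfl)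
    (g₂ := fun x ↦ (q x - μ) *
      (rexp (∫ t in 0..x, (μ - 1 - q t) * -(sin (θ t) * cos (θ t))) * sin (θ x)))
    fun x _ ↦ by
      have h3 := sin_sq_add_cos_sq (θ x)
      simp only
      linear_combination (-(μ - 1 - q x) * sin (θ x) *
        rexp (∫ t in 0..x, (μ - 1 - q t) * -(sin (θ t) * cos (θ t)))) * h3
  exact ⟨h1.continuousOn pi_pos.le, h2.continuousOn pi_pos.le, h1.eq_add_integral,
    h2.eq_add_integral⟩

theorem IsEigenpair.exists_polar {α β : ℝ} (h : IsEigenpair q α β μ y y')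
    (hq : IntervalIntegrable q volume 0 π) (hθ : IsPruferAngle (fun x ↦ μ - 1 - q x) θ 0 π)
    (hθα : θ 0 = π - α) :
    ∃ R : ℝ → ℝ, ∀ x ∈ Icc 0 π, R x ≠ 0 ∧ y x = R x * sin (θ x) ∧ y' x = R x * cos (θ x) :=
  h.1.exists_polar hq hθ h.2.1 (by
    rw [hθα, cos_pi_sub, sin_pi_sub]
    linear_combination -h.2.2.1)

theorem isEigenvalue_iff_sin_add_eq_zero {α β : ℝ} (hq : IntervalIntegrable q volume 0 π)
    (hθ : IsPruferAngle (fun x ↦ μ - 1 - q x) θ 0 π) (hθα : θ 0 = π - α) :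
    IsEigenvalue q α β μ ↔ sin (θ π + β) = 0 := by
  constructor
  · rintro ⟨y, y', h⟩
    obtain ⟨R, hR⟩ := h.exists_polar hq hθ hθα
    obtain ⟨h1, h2, h3⟩ := hR π (right_mem_Icc.2 pi_pos.le)
    have h4 := h.2.2.2
    rw [h2, h3] at h4
    refine (mul_eq_zero.1 ?_).resolve_left h1
    rw [sin_add]
    linear_combination h4
  · intro h
    obtain ⟨R, hR, hsol⟩ := hθ.exists_SLSol hq
    obtain ⟨x, hx, hx'⟩ := hθ.exists_sin_ne_zero pi_pos
    refine ⟨_, _, hsol, ⟨x, hx, mul_ne_zero (hR x) hx'⟩, ?_, ?_⟩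
    · rw [hθα, cos_pi_sub, sin_pi_sub]
      ring
    · rw [sin_add] at h
      linear_combination R π * h

end Prufer

/-- A strictly increasing map `ℕ → ℕ` whose range is downward closed is the identity. -/
theorem StrictMono.eq_self_of_isLowerSet_range {k : ℕ → ℕ} (hk : StrictMono k)
    (hr : IsLowerSet (range k)) (n : ℕ) : k n = n := by
  induction n using Nat.strong_induction_on with
  | _ n ih =>
    obtain ⟨j, hj⟩ := hr (hk.id_le n) ⟨n, rfl⟩
    have hj : k j = n := hj
    rcases lt_trichotomy j n with h | rfl | h
    · have := ih j h
      omega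
    · exact hj
    · have := hk h
      have := hk.id_le n
      simp only [id] at this
      omega

/-- Sturm oscillation theorem: if `M` enumerates the eigenvalues of `L(q, α, β)` in strictly
increasing order, then any eigenfunction corresponding to the `n`-th eigenvalue `M n` has
exactly `n` zeros in `(0, π)`, and all these zeros are simple. -/
theorem sturm_oscillation
    (q : ℝ → ℝ) (hq : IntervalIntegrable q volume 0 π)
    (α β : ℝ) (hα : α ∈ Ioc (0:ℝ) π) (hβ : β ∈ Ico (0:ℝ) π)
    (M : ℕ → ℝ) (hmono : StrictMono M)
    (henum : ∀ μ : ℝ, IsEigenvalue q α β μ ↔ ∃ n : ℕ, μ = M n) :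
    ∀ (n : ℕ) (y y' : ℝ → ℝ), IsEigenpair q α β (M n) y y' →
      ({x ∈ Ioo (0:ℝ) π | y x = 0}).ncard = n ∧
      ∀ x ∈ Ioo (0:ℝ) π, y x = 0 → y' x ≠ 0 := by
  have hp (μ : ℝ) := hq.const_sub_const_sub μ
  choose Θ hΘ0 hΘ using fun μ : ℝ ↦ exists_isPruferAngle pi_pos.le (hp μ) (π - α)
  have h0 (μ : ℝ) : 0 ≤ Θ μ 0 := by rw [hΘ0]; linarith [hα.2]
  have h0' (μ : ℝ) : Θ μ 0 < π := by rw [hΘ0]; linarith [hα.1]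
  have heig (μ : ℝ) : IsEigenvalue q α β μ ↔ sin (Θ μ π + β) = 0 :=
    isEigenvalue_iff_sin_add_eq_zero hq (hΘ μ) (hΘ0 μ)
  have hshift (μ ν : ℝ) : IsPruferAngle (fun x ↦ μ - 1 - q x + (ν - μ)) (Θ ν) 0 π := by
    convert hΘ ν using 2
    ring
  have hstrict : StrictMono fun μ ↦ Θ μ π := fun μ ν h ↦
    (hΘ μ).lt_of_add_const (hshift μ ν) pi_pos (hp μ) (sub_pos.2 h) (by rw [hΘ0, hΘ0])
  have hcont : Continuous fun μ ↦ Θ μ π := by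
    refine continuous_iff_continuousAt.2 fun μ ↦ tendsto_iff_dist_tendsto_zero.2 ?_
    have hlim : Filter.Tendsto (fun ν : ℝ ↦
        rexp (2 * ∫ x in (0 : ℝ)..π, |μ - 1 - q x|) * (|ν - μ| * (π - 0))) (nhds μ) (nhds 0) := by
      have : Continuous fun ν : ℝ ↦
        rexp (2 * ∫ x in (0 : ℝ)..π, |μ - 1 - q x|) * (|ν - μ| * (π - 0)) := by fun_prop
      simpa using this.tendsto μ
    refine squeeze_zero (fun _ ↦ dist_nonneg) (fun ν ↦ ?_) hlim
    rw [dist_comm]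
    exact (hshift μ ν).abs_sub_le_of_add_const (hΘ μ) pi_pos.le (hp μ) (by rw [hΘ0, hΘ0])
  have hpos (μ : ℝ) : 0 < Θ μ π := by
    simpa using (hΘ μ).lt_of_le_int_mul_pi (hp μ) le_rfl pi_pos le_rfl 0 (by simpa using h0 μ)
  have hidx : ∀ n, ∃ k : ℕ, Θ (M n) π = (k + 1) * π - β := by
    intro n
    obtain ⟨j, hj⟩ := sin_eq_zero_iff.1 ((heig (M n)).1 ((henum _).2 ⟨n, rfl⟩))
    have h1 : (0 : ℝ) < j * π := by linarith [hpos (M n), hβ.1]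
    have h2 : 0 < j := by exact_mod_cast pos_of_mul_pos_left h1 pi_pos.le
    refine ⟨(j - 1).toNat, ?_⟩
    have h3 : (((j - 1).toNat : ℤ) : ℝ) = j - 1 := by
      rw [Int.toNat_of_nonneg (by omega)]; push_cast; ring
    rw [Int.cast_natCast] at h3
    rw [h3]
    linarith
  choose k hk using hidx
  have hkmono : StrictMono k := fun m n hmn ↦ by
    have h1 : Θ (M m) π < Θ (M n) π := hstrict (hmono hmn)
    rw [hk, hk] at h1
    have h2 : (k m : ℝ) < k n := by nlinarith [pi_pos]
    exact_mod_cast h2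
  have hklower : IsLowerSet (range k) := by
    rintro _ i hi ⟨n, rfl⟩
    obtain ⟨μ₀, hμ₀⟩ := exists_forall_isPruferAngle_lt pi_pos hq (by linarith [hα.2])
      (show π - α < π by linarith [hα.1]) (sub_pos.2 hβ.2)
    have h1 : Θ μ₀ π ≤ (i + 1) * π - β := by
      have h2 := hμ₀ (Θ μ₀) (hΘ μ₀) (hΘ0 μ₀)
      have h3 : 0 ≤ (i : ℝ) * π := by positivity
      linarith
    have h2 : (i + 1) * π - β ≤ Θ (M n) π := by
      rw [hk]
      have h3 : (i : ℝ) ≤ k n := by exact_mod_cast hi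
      gcongr
    obtain ⟨μ, hμ⟩ := mem_range_of_exists_le_of_exists_ge hcont ⟨μ₀, h1⟩ ⟨M n, h2⟩
    have hμ : Θ μ π = (i + 1) * π - β := hμ
    obtain ⟨j, rfl⟩ := (henum μ).1 ((heig μ).2 (by
      rw [hμ, sub_add_cancel]
      exact_mod_cast sin_nat_mul_pi (i + 1)))
    refine ⟨j, ?_⟩
    rw [hk, sub_left_inj, mul_left_inj' pi_ne_zero, add_left_inj] at hμ
    exact_mod_cast hμ
  intro n y y' hy
  have hkn : Θ (M n) π = (n + 1) * π - β := by
    rw [hk, hkmono.eq_self_of_isLowerSet_range hklower]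
  obtain ⟨R, hR⟩ := hy.exists_polar hq (hΘ (M n)) (hΘ0 (M n))
  have hzero : ∀ x ∈ Ioo 0 π, (y x = 0 ↔ sin (Θ (M n) x) = 0) := fun x hx ↦ by
    obtain ⟨h1, h2, -⟩ := hR x (Ioo_subset_Icc_self hx)
    rw [h2, mul_eq_zero_iff_left h1]
  refine ⟨?_, fun x hx hyx ↦ ?_⟩
  · rw [← (hΘ (M n)).ncard_zeros pi_pos.le (hp (M n)) (h0 _) (h0' _)
      (show n * π < Θ (M n) π by linarith [hβ.2]) (by linarith [hβ.1])]
    congr 1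
    ext x
    exact and_congr_right (hzero x)
  · obtain ⟨h1, -, h3⟩ := hR x (Ioo_subset_Icc_self hx)
    rw [h3]
    refine mul_ne_zero h1 fun h4 ↦ ?_
    simpa [(hzero x hx).1 hyx, h4] using sin_sq_add_cos_sq (Θ (M n) x)
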